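/- Let δ ≥ 0 and let H be a δ-hyperbolic Busemann metric space with fixed base point w ∈ H and boundary point a ∈ ∂H. Let x, y ∈ H with h(x) ≤ h(y), let α be a geodesic from x to y, and let V_x, V_y be vertical geodesics through x and y parametrised so that h(V_x(t)) = t and h(V_y(t)) = t. Set z = α(Δh(x,y) + ½·d_r(x,y)), x₁ = V_x(h(y) + ½·d_r(x,y)) and y₁ = V_y(h(y) + ½·d_r(x,y)). Then: (1) h⁺(α) ≥ h(y) + ½·d_r(x,y) − 96δ; (2) d(z, x₁) ≤ 144δ; (3) d(z, y₁) ≤ 144δ; (4) d(x₁, y₁) ≤ 288δ. -/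

import Mathlib

open Set Filter
open scoped ENNReal NNReal

noncomputable section

namespace HP

variable {H : Type*} [MetricSpace H]

/-- `γ` restricted to `I` is an arclength-parametrised (isometric) geodesic. -/
def IsGeodesicOn (γ : ℝ → H) (I : Set ℝ) : Prop :=
  ∀ s ∈ I, ∀ t ∈ I, dist (γ s) (γ t) = |s - t|

/-- A geodesic line of `H`. -/
def IsGeodesicLine (γ : ℝ → H) : Prop := IsGeodesicOn γ Set.univ

/-- A geodesic ray of `H`, parametrised on `[0,∞)`. -/
def IsGeodesicRay (γ : ℝ → H) : Prop := IsGeodesicOn γ (Set.Ici 0)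

/-- A geodesic ray starting at `w`. -/
def IsRayFrom (w : H) (γ : ℝ → H) : Prop := IsGeodesicRay γ ∧ γ 0 = w

/-- A geodesic segment from `x` to `y`, parametrised on `[0, dist x y]`. -/
def IsGeodSegment (γ : ℝ → H) (x y : H) : Prop :=
  IsGeodesicOn γ (Set.Icc 0 (dist x y)) ∧ γ 0 = x ∧ γ (dist x y) = y

/-- The traces on `[0,∞)` of two rays are at finite Hausdorff distance. -/
def FinHausRays (γ₁ γ₂ : ℝ → H) : Prop :=
  ∃ C : ℝ, (∀ s : ℝ, 0 ≤ s → ∃ t : ℝ, 0 ≤ t ∧ dist (γ₁ s) (γ₂ t) ≤ C) ∧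
           (∀ t : ℝ, 0 ≤ t → ∃ s : ℝ, 0 ≤ s ∧ dist (γ₁ s) (γ₂ t) ≤ C)

/-- A geodesic metric space: any two points are joined by a geodesic segment. -/
def GeodesicSpace (H : Type*) [MetricSpace H] : Prop :=
  ∀ x y : H, ∃ γ : ℝ → H, IsGeodSegment γ x y

/-- `δ`-hyperbolicity: geodesic space all of whose geodesic triangles are `δ`-slim,
i.e. each side is contained in the `δ`-neighbourhood of the union of the other two. -/
def DeltaHyperbolic (H : Type*) [MetricSpace H] (δ : ℝ) : Prop :=
  GeodesicSpace H ∧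
  ∀ x y z : H, ∀ γ₁ γ₂ γ₃ : ℝ → H,
    IsGeodSegment γ₁ x y → IsGeodSegment γ₂ y z → IsGeodSegment γ₃ z x →
    ∀ s ∈ Set.Icc (0:ℝ) (dist x y),
      ∃ u ∈ γ₂ '' Set.Icc (0:ℝ) (dist y z) ∪ γ₃ '' Set.Icc (0:ℝ) (dist z x),
        dist (γ₁ s) u ≤ δ

/-- A Busemann space: geodesic, and the distance between any two
arclength-parametrised geodesics is a convex function. -/
def BusemannSpace (H : Type*) [MetricSpace H] : Prop :=
  GeodesicSpace H ∧
  ∀ (a b a' b' : ℝ) (γ γ' : ℝ → H),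
    IsGeodesicOn γ (Set.Icc a b) → IsGeodesicOn γ' (Set.Icc a' b') →
    ConvexOn ℝ (Set.Icc a b ×ˢ Set.Icc a' b')
      (fun p : ℝ × ℝ => dist (γ p.1) (γ' p.2))

/-- Geodesic completeness: every geodesic segment extends to a geodesic line. -/
def GeodesicallyComplete (H : Type*) [MetricSpace H] : Prop :=
  ∀ (a b : ℝ) (γ : ℝ → H), a ≤ b → IsGeodesicOn γ (Set.Icc a b) →
    ∃ γ' : ℝ → H, IsGeodesicLine γ' ∧ ∀ t ∈ Set.Icc a b, γ' t = γ t

/-- The Busemann function with respect to the boundary point represented by the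
geodesic ray `aRep` and the base point `w`. -/
def busemann (w : H) (aRep : ℝ → H) (x : H) : ℝ :=
  sSup { b : ℝ | ∃ k : ℝ → H, IsRayFrom w k ∧ FinHausRays aRep k ∧
    b = Filter.limsup (fun t => dist x (k t) - t) Filter.atTop }

/-- The height function: minus the Busemann function. -/
def height (w : H) (aRep : ℝ → H) (x : H) : ℝ := - busemann w aRep x

/-- A vertical geodesic (forward oriented): a geodesic line whose height tends to `+∞`. -/
def IsVerticalGeodesic (w : H) (aRep : ℝ → H) (V : ℝ → H) : Prop :=
  IsGeodesicLine V ∧ Tendsto (fun t => height w aRep (V t)) atTop atTop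

/-- A vertical geodesic line (either orientation): a geodesic line whose image lies
in the boundary class, i.e. whose height tends to `+∞` along one of its ends. -/
def IsVerticalGeodesicLine (w : H) (aRep : ℝ → H) (V : ℝ → H) : Prop :=
  IsGeodesicLine V ∧
    (Tendsto (fun t => height w aRep (V t)) atTop atTop ∨
     Tendsto (fun t => height w aRep (V t)) atBot atTop)

/-- A vertical geodesic parametrised by its height: `h(V(t)) = t` for all `t`. -/
def VertParam (w : H) (aRep : ℝ → H) (V : ℝ → H) : Prop :=
  IsGeodesicLine V ∧ ∀ t : ℝ, height w aRep (V t) = t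

/-- Height difference `Δh(x,y)`. -/
def dh (w : H) (aRep : ℝ → H) (x y : H) : ℝ :=
  |height w aRep x - height w aRep y|

/-- Relative distance `d_r(x,y) = d(x,y) - Δh(x,y)`. -/
def dr (w : H) (aRep : ℝ → H) (x y : H) : ℝ := dist x y - dh w aRep x y

/-- Maximal height `h⁺` of a path along the parameter set `I`. -/
def hplusOn (w : H) (aRep : ℝ → H) (γ : ℝ → H) (I : Set ℝ) : ℝ :=
  sSup ((fun t => height w aRep (γ t)) '' I)

/-- Minimal height `h⁻` of a path along the parameter set `I`. -/
def hminusOn (w : H) (aRep : ℝ → H) (γ : ℝ → H) (I : Set ℝ) : ℝ :=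
  sInf ((fun t => height w aRep (γ t)) '' I)

/-- A path parametrised by arclength: the length of the piece on `[s,t]` equals `t - s`. -/
def ArclengthPath (V : ℝ → H) : Prop :=
  ∀ s t : ℝ, s ≤ t → eVariationOn V (Set.Icc s t) = ENNReal.ofReal (t - s)

/-- An admissible norm on `ℝ²`: a norm with `N(1,1) = 1` and `N(a,b) ≥ (a+b)/2`. -/
structure AdmNorm where
  toFun : ℝ × ℝ → ℝ
  eq_zero_iff : ∀ v : ℝ × ℝ, toFun v = 0 ↔ v = 0
  smul_eq : ∀ (c : ℝ) (v : ℝ × ℝ), toFun (c • v) = |c| * toFun v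
  add_le : ∀ v w : ℝ × ℝ, toFun (v + w) ≤ toFun v + toFun w
  one_one : toFun (1, 1) = 1
  adm : ∀ a b : ℝ, (a + b) / 2 ≤ toFun (a, b)

/-- `C` is a comparison constant `C_N` for the admissible norm `N`:
`C ≥ 1` and `N(a,b) ≤ C(a+b)/2` for all `a,b ≥ 0`. -/
def AdmNorm.BoundConst (N : AdmNorm) (C : ℝ) : Prop :=
  1 ≤ C ∧ ∀ a b : ℝ, 0 ≤ a → 0 ≤ b → N.toFun (a, b) ≤ C * (a + b) / 2

variable {Hp Hq : Type*} [MetricSpace Hp] [MetricSpace Hq]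

/-- Membership in the horospherical product: `h_p(x_p) + h_q(x_q) = 0`. -/
def inHoro (wp : Hp) (ap : ℝ → Hp) (wq : Hq) (aq : ℝ → Hq) (z : Hp × Hq) : Prop :=
  height wp ap z.1 + height wq aq z.2 = 0

/-- The `N`-length of a path in `Hp × Hq`: supremum over finite monotone
subdivisions of the sums of the `N(d_p, d_q)`-distances. -/
def lN (Nf : ℝ × ℝ → ℝ) (γ : ℝ → Hp × Hq) (s : Set ℝ) : ℝ≥0∞ :=
  ⨆ p : ℕ × { u : ℕ → ℝ // Monotone u ∧ ∀ i, u i ∈ s },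
    ∑ i ∈ Finset.range p.1,
      ENNReal.ofReal (Nf (dist (γ (p.2.1 (i+1))).1 (γ (p.2.1 i)).1,
                          dist (γ (p.2.1 (i+1))).2 (γ (p.2.1 i)).2))

/-- The `N`-path metric: infimum of `N`-lengths of connected paths staying in the
horospherical product and joining the two points. -/
def dHN (Nf : ℝ × ℝ → ℝ) (mem : Hp × Hq → Prop) (x y : Hp × Hq) : ℝ≥0∞ :=
  ⨅ (T : ℝ) (_ : 0 ≤ T) (γ : ℝ → Hp × Hq) (_ : ContinuousOn γ (Set.Icc 0 T))
    (_ : ∀ t ∈ Set.Icc (0:ℝ) T, mem (γ t)) (_ : γ 0 = x) (_ : γ T = y),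
    lN Nf γ (Set.Icc 0 T)

/-- A geodesic of the horospherical product with respect to the `N`-path metric,
parametrised (by arclength) on `I` and staying in the product. -/
def IsHNGeodesicOn (Nf : ℝ × ℝ → ℝ) (mem : Hp × Hq → Prop)
    (α : ℝ → Hp × Hq) (I : Set ℝ) : Prop :=
  (∀ t ∈ I, mem (α t)) ∧
  ∀ s ∈ I, ∀ t ∈ I, dHN Nf mem (α s) (α t) = ENNReal.ofReal |s - t|

/-- A vertical geodesic of the horospherical product, parametrised by its height. -/
def IsHNVerticalLine (Nf : ℝ × ℝ → ℝ) (mem : Hp × Hq → Prop)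
    (wp : Hp) (ap : ℝ → Hp) (V : ℝ → Hp × Hq) : Prop :=
  IsHNGeodesicOn Nf mem V Set.univ ∧ ∀ t : ℝ, height wp ap (V t).1 = t

/-- Maximal height `h⁺` of a path of the horospherical product. -/
def hplusH (wp : Hp) (ap : ℝ → Hp) (γ : ℝ → Hp × Hq) (I : Set ℝ) : ℝ :=
  sSup ((fun t => height wp ap (γ t).1) '' I)

/-- Minimal height `h⁻` of a path of the horospherical product. -/
def hminusH (wp : Hp) (ap : ℝ → Hp) (γ : ℝ → Hp × Hq) (I : Set ℝ) : ℝ :=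
  sInf ((fun t => height wp ap (γ t).1) '' I)

/-- `H_p`-type path at scale `κ`: the first component stays `κ`-close to a geodesic
of `H_p` and the second component stays `κ`-close to a vertical geodesic of `H_q`. -/
def IsHpType (wq : Hq) (aq : ℝ → Hq) (κ : ℝ) (α : ℝ → Hp × Hq) : Prop :=
  (∃ g : ℝ → Hp, IsGeodesicLine g ∧ ∀ t : ℝ, ∃ s : ℝ, dist (α t).1 (g s) ≤ κ) ∧
  (∃ v : ℝ → Hq, IsVerticalGeodesicLine wq aq v ∧ ∀ t : ℝ, ∃ s : ℝ, dist (α t).2 (v s) ≤ κ)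

/-- `H_q`-type path at scale `κ`. -/
def IsHqType (wp : Hp) (ap : ℝ → Hp) (κ : ℝ) (α : ℝ → Hp × Hq) : Prop :=
  (∃ g : ℝ → Hq, IsGeodesicLine g ∧ ∀ t : ℝ, ∃ s : ℝ, dist (α t).2 (g s) ≤ κ) ∧
  (∃ v : ℝ → Hp, IsVerticalGeodesicLine wp ap v ∧ ∀ t : ℝ, ∃ s : ℝ, dist (α t).1 (v s) ≤ κ)

/-- Finite Hausdorff distance on `[0,∞)` between two rays, for a generalized
(`ℝ≥0∞`-valued) distance `dd`. -/
def HNFinHaus {X : Type*} (dd : X → X → ℝ≥0∞) (α β : ℝ → X) : Prop :=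
  ∃ C : ℝ, (∀ s : ℝ, 0 ≤ s → ∃ t : ℝ, 0 ≤ t ∧ dd (α s) (β t) ≤ ENNReal.ofReal C) ∧
           (∀ t : ℝ, 0 ≤ t → ∃ s : ℝ, 0 ≤ s ∧ dd (α s) (β t) ≤ ENNReal.ofReal C)

theorem finHaus_equivalence (H : Type*) [MetricSpace H] :
    Equivalence (fun γ₁ γ₂ : {γ : ℝ → H // IsGeodesicRay γ} => FinHausRays γ₁.1 γ₂.1) := by
  constructor
  · intro γ
    exact ⟨0, fun s hs => ⟨s, hs, by simp⟩, fun t ht => ⟨t, ht, by simp⟩⟩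
  · rintro γ₁ γ₂ ⟨C, h1, h2⟩
    refine ⟨C, fun s hs => ?_, fun t ht => ?_⟩
    · obtain ⟨u, hu, hd⟩ := h2 s hs
      exact ⟨u, hu, by rwa [dist_comm]⟩
    · obtain ⟨u, hu, hd⟩ := h1 t ht
      exact ⟨u, hu, by rwa [dist_comm]⟩
  · rintro γ₁ γ₂ γ₃ ⟨C, h1, h2⟩ ⟨D, g1, g2⟩
    refine ⟨C + D, fun s hs => ?_, fun t ht => ?_⟩
    · obtain ⟨u, hu, hd⟩ := h1 s hs
      obtain ⟨v, hv, he⟩ := g1 u hu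
      exact ⟨v, hv, (dist_triangle _ (γ₂.1 u) _).trans (add_le_add hd he)⟩
    · obtain ⟨u, hu, hd⟩ := g2 t ht
      obtain ⟨v, hv, he⟩ := h2 u hu
      exact ⟨v, hv, (dist_triangle _ (γ₂.1 u) _).trans (add_le_add he hd)⟩

/-- The setoid of geodesic rays up to finite Hausdorff distance. -/
instance raySetoid (H : Type*) [MetricSpace H] : Setoid {γ : ℝ → H // IsGeodesicRay γ} :=
  ⟨fun γ₁ γ₂ => FinHausRays γ₁.1 γ₂.1, finHaus_equivalence H⟩

/-- The Gromov boundary: equivalence classes of geodesic rays at finite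
Hausdorff distance. -/
abbrev Bdry (H : Type*) [MetricSpace H] := Quotient (raySetoid H)

/-- The boundary point determined by a geodesic ray. -/
def bdryPt {H : Type*} [MetricSpace H] (γ : ℝ → H) (h : IsGeodesicRay γ) : Bdry H :=
  Quotient.mk (raySetoid H) ⟨γ, h⟩

/-- The set `((∂H_p ∖ {a_p}) × {a_q}) ∪ ({a_p} × (∂H_q ∖ {a_q}))`. -/
def bdryTarget {Hp Hq : Type*} [MetricSpace Hp] [MetricSpace Hq]
    (ap : ℝ → Hp) (hap : IsGeodesicRay ap)
    (aq : ℝ → Hq) (haq : IsGeodesicRay aq) : Set (Bdry Hp × Bdry Hq) :=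
  ((({bdryPt ap hap} : Set (Bdry Hp))ᶜ ×ˢ ({bdryPt aq haq} : Set (Bdry Hq))) ∪
   (({bdryPt ap hap} : Set (Bdry Hp)) ×ˢ ({bdryPt aq haq} : Set (Bdry Hq))ᶜ))

theorem IsGeodSegment.dist_left {γ : ℝ → H} {x y : H} (h : IsGeodSegment γ x y) {s : ℝ}
    (hs : s ∈ Set.Icc 0 (dist x y)) : dist x (γ s) = s := by
  obtain ⟨h, h0, -⟩ := h
  have := h 0 ⟨le_rfl, dist_nonneg⟩ s hs
  rwa [h0, zero_sub, abs_neg, abs_of_nonneg hs.1] at this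

theorem IsGeodSegment.dist_right {γ : ℝ → H} {x y : H} (h : IsGeodSegment γ x y) {s : ℝ}
    (hs : s ∈ Set.Icc 0 (dist x y)) : dist (γ s) y = dist x y - s := by
  obtain ⟨h, -, h1⟩ := h
  have := h s hs (dist x y) ⟨dist_nonneg, le_rfl⟩
  rwa [h1, abs_sub_comm, abs_of_nonneg (sub_nonneg.2 hs.2)] at this

/-- In a `δ`-slim triangle, a point almost aligned between `x` and `p` is close to any
geodesic from `x` to `p`. -/
theorem DeltaHyperbolic.dist_geodSegment_le {δ : ℝ} (hH : DeltaHyperbolic H δ) {x p z : H}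
    {η : ℝ} (hη : 0 ≤ η) (hz : dist x z + dist z p ≤ dist x p + η) (hle : dist x z ≤ dist x p)
    {g : ℝ → H} (hg : IsGeodSegment g x p) : dist z (g (dist x z)) ≤ 2 * δ + η := by
  obtain ⟨g₂, hg₂⟩ := hH.1 p z
  obtain ⟨g₃, hg₃⟩ := hH.1 z x
  have hs : dist x z ∈ Set.Icc 0 (dist x p) := ⟨dist_nonneg, hle⟩
  obtain ⟨u, hu, hd⟩ := hH.2 x p z g g₂ g₃ hg hg₂ hg₃ _ hs
  have h1 := hg.dist_left hs
  have h2 := hg.dist_right hs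
  have h3 := dist_triangle z u (g (dist x z))
  rw [dist_comm u] at h3
  rcases hu with ⟨r, hr, rfl⟩ | ⟨r, hr, rfl⟩
  · have h4 := hg₂.dist_left hr
    have h5 := hg₂.dist_right hr
    have h6 := dist_triangle (g (dist x z)) (g₂ r) p
    rw [dist_comm (g₂ r) p] at h6
    rw [dist_comm (g₂ r) z, dist_comm p z] at h5
    linarith
  · have h4 := hg₃.dist_left hr
    have h5 := hg₃.dist_right hr
    have h6 := dist_triangle x (g₃ r) (g (dist x z))
    rw [dist_comm x (g₃ r), dist_comm (g₃ r) (g _)] at h6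
    rw [dist_comm z x] at h5
    linarith

/-- Two points at the same distance from `x`, both almost aligned between `x` and `p`,
are close to each other. -/
theorem DeltaHyperbolic.dist_le_of_almost_aligned {δ : ℝ} (hH : DeltaHyperbolic H δ)
    {x p z z' : H} {η η' : ℝ} (hη : 0 ≤ η) (hη' : 0 ≤ η')
    (hz : dist x z + dist z p ≤ dist x p + η) (hz' : dist x z' + dist z' p ≤ dist x p + η')
    (heq : dist x z = dist x z') (hle : dist x z ≤ dist x p) :
    dist z z' ≤ 4 * δ + η + η' := by
  obtain ⟨g, hg⟩ := hH.1 x p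
  have h1 := hH.dist_geodSegment_le hη hz hle hg
  have h2 := hH.dist_geodSegment_le hη' hz' (heq ▸ hle) hg
  rw [← heq, dist_comm] at h2
  linarith [dist_triangle z (g (dist x z)) z']

theorem DeltaHyperbolic.dist_apex_le {δ : ℝ} (hH : DeltaHyperbolic H δ) {x y : H} (p : H)
    {α : ℝ → H} (hα : IsGeodSegment α x y) {s : ℝ} (hs : s ∈ Set.Icc 0 (dist x y)) :
    dist (α s) p ≤ max (dist x p - s) (dist y p - (dist x y - s)) + 2 * δ := by
  obtain ⟨g₂, hg₂⟩ := hH.1 y p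
  obtain ⟨g₃, hg₃⟩ := hH.1 p x
  obtain ⟨u, hu, hd⟩ := hH.2 x y p α g₂ g₃ hα hg₂ hg₃ s hs
  have h1 := hα.dist_left hs
  have h2 := hα.dist_right hs
  have h3 := dist_triangle (α s) u p
  rcases hu with ⟨r, hr, rfl⟩ | ⟨r, hr, rfl⟩
  · have h5 := hg₂.dist_right hr
    have h4 := hg₂.dist_left hr
    have h6 := dist_triangle (α s) (g₂ r) y
    rw [dist_comm (g₂ r) y] at h6
    linarith [le_max_right (dist x p - s) (dist y p - (dist x y - s))]
  · have h5 := hg₃.dist_right hr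
    have h4 := hg₃.dist_left hr
    have h6 := dist_triangle (α s) (g₃ r) x
    rw [dist_comm (α s) x] at h6
    rw [dist_comm p x] at h5
    rw [dist_comm (g₃ r) p] at h3
    linarith [le_max_left (dist x p - s) (dist y p - (dist x y - s))]

/-- In a Busemann space, two asymptotic rays from the same point coincide. -/
theorem BusemannSpace.ray_unique (hB : BusemannSpace H) {w : H} {a k : ℝ → H}
    (ha : IsRayFrom w a) (hk : IsRayFrom w k) (hak : FinHausRays a k) {s : ℝ} (hs : 0 ≤ s) :
    a s = k s := by
  obtain ⟨C, hC, -⟩ := hak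
  have hbound : ∀ s : ℝ, 0 ≤ s → dist (a s) (k s) ≤ 2 * C := by
    intro s hs
    obtain ⟨t, ht, hd⟩ := hC s hs
    have h1 := ha.1 0 self_mem_Ici s hs
    have h2 := hk.1 0 self_mem_Ici t ht
    have h3 := hk.1 t ht s hs
    rw [ha.2, zero_sub, abs_neg, abs_of_nonneg hs] at h1
    rw [hk.2, zero_sub, abs_neg, abs_of_nonneg ht] at h2
    have h4 := dist_triangle w (a s) (k t)
    have h5 := dist_triangle w (k t) (a s)
    rw [dist_comm (k t)] at h5
    have h6 : |t - s| ≤ C := abs_le.2 ⟨by linarith, by linarith⟩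
    linarith [dist_triangle (a s) (k t) (k s)]
  have hconv : ∀ n : ℝ, s ≤ n → 0 < n → dist (a s) (k s) ≤ s * (2 * C) / n := by
    intro n hn hn0
    have hsub : Set.Icc 0 n ⊆ Set.Ici 0 := fun t ht => ht.1
    have hcvx := (hB.2 0 n 0 n a k (fun u hu v hv => ha.1 u (hsub hu) v (hsub hv))
      (fun u hu v hv => hk.1 u (hsub hu) v (hsub hv))).2
    have h := hcvx
      (x := (0, 0)) ⟨⟨le_rfl, hn0.le⟩, ⟨le_rfl, hn0.le⟩⟩
      (y := (n, n)) ⟨⟨hn0.le, le_rfl⟩, ⟨hn0.le, le_rfl⟩⟩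
      (a := 1 - s / n) (b := s / n) (sub_nonneg.2 (div_le_one_of_le₀ hn hn0.le))
      (div_nonneg hs hn0.le) (by ring)
    have hsn : s / n * n = s := div_mul_cancel₀ s hn0.ne'
    simp only [Prod.smul_mk, smul_eq_mul, mul_zero, Prod.mk_add_mk, zero_add, hsn, ha.2, hk.2,
      dist_self] at h
    calc dist (a s) (k s) ≤ s / n * dist (a n) (k n) := h
      _ ≤ s / n * (2 * C) := mul_le_mul_of_nonneg_left (hbound n hn0.le) (div_nonneg hs hn0.le)
      _ = s * (2 * C) / n := by ring
  have hlim : Tendsto (fun n : ℝ => s * (2 * C) / n) atTop (nhds 0) :=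
    tendsto_const_nhds.div_atTop tendsto_id
  refine dist_le_zero.1 (ge_of_tendsto hlim ?_)
  filter_upwards [eventually_ge_atTop s, eventually_gt_atTop 0] with n hn hn0
  exact hconv n hn hn0

theorem BusemannSpace.tendsto_busemann (hB : BusemannSpace H) {w : H} {a : ℝ → H}
    (ha : IsRayFrom w a) (x : H) :
    Tendsto (fun t => dist x (a t) - t) atTop (nhds (busemann w a x)) := by
  have hanti : Antitone (fun t : ℝ => dist x (a (max t 0)) - max t 0) := by
    intro s t hst
    have hle : max s 0 ≤ max t 0 := max_le_max_right 0 hst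
    have h := ha.1 (max s 0) (le_max_right s 0) (max t 0) (le_max_right t 0)
    rw [abs_sub_comm, abs_of_nonneg (sub_nonneg.2 hle)] at h
    have := dist_triangle x (a (max s 0)) (a (max t 0))
    dsimp only
    linarith
  have hbdd : BddBelow (range fun t : ℝ => dist x (a (max t 0)) - max t 0) := by
    refine ⟨-dist x w, ?_⟩
    rintro _ ⟨t, rfl⟩
    have h := ha.1 0 self_mem_Ici (max t 0) (le_max_right t 0)
    rw [ha.2, zero_sub, abs_neg, abs_of_nonneg (le_max_right t 0)] at h
    have := dist_triangle_left w (a (max t 0)) x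
    dsimp only
    linarith
  have hlim := (tendsto_atTop_ciInf hanti hbdd).congr' (f₂ := fun t => dist x (a t) - t) (by
    filter_upwards [eventually_ge_atTop 0] with t ht
    rw [max_eq_left ht])
  have hset : { b : ℝ | ∃ k : ℝ → H, IsRayFrom w k ∧ FinHausRays a k ∧
      b = Filter.limsup (fun t => dist x (k t) - t) Filter.atTop } =
      {Filter.limsup (fun t => dist x (a t) - t) Filter.atTop} := by
    ext b
    constructor
    · rintro ⟨k, hk, hak, rfl⟩
      refine limsup_congr ?_
      filter_upwards [eventually_ge_atTop 0] with t ht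
      rw [hB.ray_unique ha hk hak ht]
    · rintro rfl
      exact ⟨a, ha, ⟨0, fun s hs => ⟨s, hs, by simp⟩, fun t ht => ⟨t, ht, by simp⟩⟩, rfl⟩
  have hbus : busemann w a x = Filter.limsup (fun t => dist x (a t) - t) Filter.atTop := by
    rw [busemann, hset, csSup_singleton]
  rw [hbus, hlim.limsup_eq]
  exact hlim

theorem BusemannSpace.eventually_dist_ray (hB : BusemannSpace H) {w : H} {a : ℝ → H}
    (ha : IsRayFrom w a) (x : H) {ε : ℝ} (hε : 0 < ε) :
    ∀ᶠ t in atTop, |dist x (a t) - (t - height w a x)| < ε := by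
  filter_upwards [Metric.tendsto_nhds.1 (hB.tendsto_busemann ha x) ε hε] with t ht
  rw [Real.dist_eq] at ht
  rw [height]
  convert ht using 2
  ring

theorem BusemannSpace.height_sub_le_dist (hB : BusemannSpace H) {w : H} {a : ℝ → H}
    (ha : IsRayFrom w a) (x y : H) : height w a y - height w a x ≤ dist x y := by
  rw [height, height, sub_neg_eq_add, neg_add_eq_sub]
  refine le_of_tendsto ((hB.tendsto_busemann ha x).sub (hB.tendsto_busemann ha y))
    (Eventually.of_forall fun t => ?_)
  linarith [dist_triangle x y (a t)]

theorem VertParam.dist_eq {w : H} {a V : ℝ → H} (hV : VertParam w a V) {x : H}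
    (hx : V (height w a x) = x) {t : ℝ} (ht : height w a x ≤ t) :
    dist x (V t) = t - height w a x := by
  have h := hV.1 (height w a x) (mem_univ _) t (mem_univ _)
  rwa [hx, abs_sub_comm, abs_of_nonneg (sub_nonneg.2 ht)] at h

/-- A point at height-distance from `x` along a vertical geodesic is close to any point `z`
which is as far from `x` and almost aligned with the far end of the ray `a`. -/
theorem dist_vertical_le {δ ε : ℝ} (hδ : 0 ≤ δ) (hε : 0 ≤ ε) (hH : DeltaHyperbolic H δ)
    {w : H} {a V : ℝ → H} (hV : VertParam w a V) {x : H} (hx : V (height w a x) = x)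
    {T t : ℝ} (hT : height w a x ≤ T) (ht : T + ε ≤ t) {z : H}
    (hxz : dist x z = T - height w a x)
    (hx' : |dist x (a t) - (t - height w a x)| ≤ ε)
    (hV' : |dist (V T) (a t) - (t - T)| ≤ ε)
    (hz : dist z (a t) ≤ t - T + ε + 2 * δ) :
    dist z (V T) ≤ 6 * δ + 4 * ε := by
  have hd := hV.dist_eq hx hT
  rw [abs_le] at hx' hV'
  have := hH.dist_le_of_almost_aligned (x := x) (p := a t) (z := z) (z' := V T)
    (η := 2 * δ + 2 * ε) (η' := 2 * ε) (by positivity) (by positivity) (by linarith)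
    (by linarith) (by rw [hd, hxz]) (by linarith)
  linarith

/-- A geodesic between `x` and `y` with `h(x) ≤ h(y)` climbs up to
height `h(y) + ½ d_r(x,y)` (up to `96δ`), and its point at time
`Δh(x,y) + ½ d_r(x,y)` is `144δ`-close to the corresponding points of the
vertical geodesics through `x` and `y`. -/
theorem statement3 {H : Type*} [MetricSpace H]
    (δ : ℝ) (hδ : 0 ≤ δ) (hH : DeltaHyperbolic H δ) (hB : BusemannSpace H)
    (w : H) (a : ℝ → H) (ha : IsRayFrom w a)
    (x y : H) (hxy : height w a x ≤ height w a y)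
    (α : ℝ → H) (hα : IsGeodSegment α x y)
    (Vx : ℝ → H) (hVx : VertParam w a Vx) (hVxx : Vx (height w a x) = x)
    (Vy : ℝ → H) (hVy : VertParam w a Vy) (hVyy : Vy (height w a y) = y) :
    height w a y + dr w a x y / 2 - 96 * δ ≤ hplusOn w a α (Set.Icc 0 (dist x y)) ∧
    dist (α (dh w a x y + dr w a x y / 2)) (Vx (height w a y + dr w a x y / 2)) ≤ 144 * δ ∧
    dist (α (dh w a x y + dr w a x y / 2)) (Vy (height w a y + dr w a x y / 2)) ≤ 144 * δ ∧
    dist (Vx (height w a y + dr w a x y / 2)) (Vy (height w a y + dr w a x y / 2)) ≤ 288 * δ := by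
  have hdh : dh w a x y = height w a y - height w a x := by
    rw [dh, abs_sub_comm, abs_of_nonneg (sub_nonneg.2 hxy)]
  have hdr : dr w a x y = dist x y - (height w a y - height w a x) := by rw [dr, hdh]
  have hlip := hB.height_sub_le_dist ha x y
  have hdr0 : 0 ≤ dr w a x y := by linarith
  set T := height w a y + dr w a x y / 2 with hT
  set s := dh w a x y + dr w a x y / 2 with hs
  have hsI : s ∈ Set.Icc 0 (dist x y) := ⟨by linarith, by linarith⟩
  have hzx := hα.dist_left hsI
  have hzy := hα.dist_right hsI
  rw [dist_comm] at hzy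
  have key : dist (α s) (Vx T) ≤ 6 * δ ∧ dist (α s) (Vy T) ≤ 6 * δ := by
    suffices h : ∀ ε : ℝ, 0 < ε →
        dist (α s) (Vx T) ≤ 6 * δ + 4 * ε ∧ dist (α s) (Vy T) ≤ 6 * δ + 4 * ε by
      constructor
      · refine le_of_forall_pos_le_add fun ε hε => ?_
        linarith [(h (ε / 4) (by positivity)).1]
      · refine le_of_forall_pos_le_add fun ε hε => ?_
        linarith [(h (ε / 4) (by positivity)).2]
    intro ε hε
    have hVxT := hB.eventually_dist_ray ha (Vx T) hε
    have hVyT := hB.eventually_dist_ray ha (Vy T) hε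
    rw [hVx.2 T] at hVxT
    rw [hVy.2 T] at hVyT
    obtain ⟨t, htx, hty, htVx, htVy, ht⟩ := ((hB.eventually_dist_ray ha x hε).and
      ((hB.eventually_dist_ray ha y hε).and (hVxT.and (hVyT.and
        (eventually_ge_atTop (T + ε)))))).exists
    have hz : dist (α s) (a t) ≤ t - T + ε + 2 * δ := by
      refine (hH.dist_apex_le (a t) hα hsI).trans (add_le_add_left (max_le ?_ ?_) _)
      · linarith [(abs_lt.1 htx).2]
      · linarith [(abs_lt.1 hty).2]
    exact ⟨dist_vertical_le hδ hε.le hH hVx hVxx (by linarith) ht (by linarith) htx.le htVx.le hz,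
      dist_vertical_le hδ hε.le hH hVy hVyy (by linarith) ht (by linarith) hty.le htVy.le hz⟩
  obtain ⟨hzx₁, hzy₁⟩ := key
  refine ⟨?_, by linarith, by linarith, ?_⟩
  · have hbdd : BddAbove ((fun t => height w a (α t)) '' Set.Icc 0 (dist x y)) := by
      refine ⟨height w a x + dist x y, ?_⟩
      rintro _ ⟨r, hr, rfl⟩
      have h1 := hB.height_sub_le_dist ha x (α r)
      rw [hα.dist_left hr] at h1
      dsimp only
      linarith [hr.2]
    have hle : height w a (α s) ≤ hplusOn w a α (Set.Icc 0 (dist x y)) :=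
      le_csSup hbdd ⟨s, hsI, rfl⟩
    have h1 := hB.height_sub_le_dist ha (α s) (Vx T)
    rw [hVx.2 T] at h1
    linarith
  · linarith [dist_triangle_left (Vx T) (Vy T) (α s)]

end HP

end
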